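/- arXiv:1803.08755 — 2 statements merged into one kernel-verified Lean document; each statement's English description precedes it below -/
import Mathlib

section
/- Let d ≥ 6 be a composite integer and let ℓ be the smallest prime factor of d. Then D_d(H) ≍ H^{d/ℓ}, i.e. there exist constants c₁, c₂ > 0 (depending only on d) such that for all integers H ≥ 2, c₁·H^{d/ℓ} ≤ D_d(H) ≤ c₂·H^{d/ℓ}. -/
open Polynomial

/-- The height of an integer polynomial is at most `H`. -/
def HeightLe (f : ℤ[X]) (H : ℕ) : Prop := ∀ i, |f.coeff i| ≤ (H : ℤ)

/-- A polynomial is decomposable if it is a composition of two polynomials of degree `≥ 2`. -/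
def Decomposable (f : ℤ[X]) : Prop :=
  ∃ g h : ℤ[X], 2 ≤ g.natDegree ∧ 2 ≤ h.natDegree ∧ f = g.comp h

/-- `DdMonic d H` is the number of decomposable monic integer polynomials of degree `d`
and height at most `H`. -/
noncomputable def DdMonic (d : ℕ) (H : ℕ) : ℕ :=
  Nat.card {f : ℤ[X] // f.Monic ∧ f.natDegree = d ∧ HeightLe f H ∧ Decomposable f}


lemma normalize_decomp (f : ℤ[X]) (hf : f.Monic) (hdec : Decomposable f) :
    ∃ g h : ℤ[X], g.Monic ∧ h.Monic ∧ 2 ≤ g.natDegree ∧ 2 ≤ h.natDegree ∧ h.coeff 0 = 0 ∧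
      f = g.comp h := by
  obtain ⟨g, h, hg, hh, rfl⟩ := hdec
  have hlc : g.leadingCoeff * h.leadingCoeff ^ g.natDegree = 1 := by
    rw [← leadingCoeff_comp (by omega)]; exact hf
  have hu : IsUnit h.leadingCoeff := by
    have h1 : IsUnit (h.leadingCoeff ^ g.natDegree) := IsUnit.of_mul_eq_one_right _ hlc
    exact (isUnit_pow_iff (by omega)).1 h1
  set u := h.leadingCoeff with hudef
  have huu : u * u = 1 := by
    rcases Int.isUnit_iff.1 hu with h1 | h1 <;> rw [h1] <;> norm_num
  have hu0 : u ≠ 0 := hu.ne_zero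
  have hdeg : (h - C (h.coeff 0)).natDegree = h.natDegree := natDegree_sub_C
  have hdeg' : (C u * (h - C (h.coeff 0))).natDegree = h.natDegree := by
    rw [natDegree_C_mul hu0, hdeg]
  have hmon : (C u * (h - C (h.coeff 0))).Monic := by
    have : (h - C (h.coeff 0)).leadingCoeff = u := by
      rw [leadingCoeff, hdeg, coeff_sub, coeff_C, if_neg (by omega), sub_zero, hudef, leadingCoeff]
    rw [Monic, leadingCoeff_mul, leadingCoeff_C, this, huu]
  have hcomp : g.comp h = (g.comp (C u * X + C (h.coeff 0))).comp (C u * (h - C (h.coeff 0))) := by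
    rw [comp_assoc]
    congr 1
    simp only [add_comp, mul_comp, C_comp, X_comp]
    rw [← mul_assoc, ← C_mul, huu]
    simp
  have hgd : (g.comp (C u * X + C (h.coeff 0))).natDegree = g.natDegree := by
    rw [natDegree_comp, natDegree_linear hu0, mul_one]
  refine ⟨g.comp (C u * X + C (h.coeff 0)), C u * (h - C (h.coeff 0)), ?_, hmon, by omega, by omega,
    by simp, hcomp⟩
  rw [hcomp, Monic, leadingCoeff_comp (by omega), hmon.leadingCoeff, one_pow, mul_one] at hf
  exact hf

lemma coeff_prod_bound (s : Multiset ℂ) (A : ℝ) (hA : 0 ≤ A) (i : ℕ) :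
    ‖((s.map fun b => X - C b).prod).coeff i‖ * A ^ i ≤
      2 ^ (Multiset.card s) * (s.map fun b => max A ‖b‖).prod := by
  induction s using Multiset.induction_on generalizing i with
  | empty =>
    simp only [Multiset.map_zero, Multiset.prod_zero, coeff_one]
    split_ifs with h
    · simp [h]
    · simp
  | cons b s ih =>
    simp only [Multiset.map_cons, Multiset.prod_cons, Multiset.card_cons]
    set p := (s.map fun b => X - C b).prod
    set P := (s.map fun b => max A ‖b‖).prod
    have hP : 0 ≤ 2 ^ (Multiset.card s) * P := by
      apply le_trans _ (ih 0)
      positivity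
    have hb : ‖b‖ * (‖p.coeff i‖ * A ^ i) ≤ max A ‖b‖ * (2 ^ (Multiset.card s) * P) :=
      mul_le_mul (le_max_right _ _) (ih i) (by positivity) (by positivity)
    rw [sub_mul, coeff_sub, coeff_C_mul]
    rcases i with _ | i
    · simp only [mul_coeff_zero, coeff_X_zero, zero_mul, zero_sub, norm_neg, norm_mul, pow_zero,
        mul_one] at hb ⊢
      have h0 : 0 ≤ max A ‖b‖ * (2 ^ (Multiset.card s) * P) := by positivity
      calc _ ≤ _ := hb
        _ ≤ max A ‖b‖ * (2 ^ (Multiset.card s) * P) + max A ‖b‖ * (2 ^ (Multiset.card s) * P) := by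
          linarith
        _ = _ := by ring
    · rw [coeff_X_mul]
      have ha : A * (‖p.coeff i‖ * A ^ i) ≤ max A ‖b‖ * (2 ^ (Multiset.card s) * P) :=
        mul_le_mul (le_max_left _ _) (ih i) (by positivity) (by positivity)
      calc _ ≤ (‖p.coeff i‖ + ‖b‖ * ‖p.coeff (i+1)‖) * A ^ (i+1) := by
            gcongr
            exact (norm_sub_le _ _).trans (by rw [norm_mul])
        _ = A * (‖p.coeff i‖ * A ^ i) + ‖b‖ * (‖p.coeff (i+1)‖ * A ^ (i+1)) := by ring
        _ ≤ max A ‖b‖ * (2 ^ (Multiset.card s) * P) + max A ‖b‖ * (2 ^ (Multiset.card s) * P) :=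
            add_le_add ha hb
        _ = _ := by ring

lemma multiset_prod_le_of_le (s : Multiset ℂ) (F G : ℂ → ℝ) (c : ℝ)
    (hF : ∀ b, 0 ≤ F b) (h : ∀ b, F b ≤ c * G b) :
    (s.map F).prod ≤ c ^ (Multiset.card s) * (s.map G).prod := by
  have h1 : (s.map F).prod ≤ (s.map fun b => c * G b).prod :=
    Multiset.prod_map_le_prod_map₀ _ _ (fun b _ => hF b) (fun b _ => h b)
  rwa [Multiset.prod_map_mul, Multiset.map_const', Multiset.prod_replicate] at h1

lemma pow_card_le_prod_max (s : Multiset ℂ) (A : ℝ) (hA : 0 ≤ A) :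
    A ^ (Multiset.card s) ≤ (s.map fun b => max A ‖b‖).prod := by
  have h1 : (s.map fun _ => A).prod ≤ (s.map fun b => max A ‖b‖).prod :=
    Multiset.prod_map_le_prod_map₀ _ _ (fun b _ => hA) (fun b _ => le_max_left _ _)
  rwa [Multiset.map_const', Multiset.prod_replicate] at h1

lemma key_bound (g h : ℤ[X]) (hg : g.Monic) (hh0 : h.coeff 0 = 0)
    (H A : ℕ) (hA : ∃ i, i ≠ 0 ∧ (h.coeff i).natAbs = A) (hH : HeightLe (g.comp h) H) (m d : ℕ)
    (hm : g.natDegree = m) (hd : m * h.natDegree = d) :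
    A ^ m ≤ 2 ^ m * 2 ^ d * (d + 1) * H ∧
    ∀ k, (g.coeff k).natAbs * A ^ k ≤ 2 ^ m * 2 ^ d * (d + 1) * H := by
  set φ := Int.castRingHom ℂ
  have hinj : Function.Injective φ := Int.cast_injective
  set gc := g.map φ with hgc
  set hc := h.map φ with hhc
  have hgcm : gc.Monic := hg.map φ
  have hsplit : gc.Splits := IsAlgClosed.splits gc
  have hgprod : gc = (gc.roots.map fun b => X - C b).prod :=
    hsplit.eq_prod_roots_of_monic hgcm
  have hcard : Multiset.card gc.roots = m := by
    rw [← hsplit.natDegree_eq_card_roots, hgc, natDegree_map_eq_of_injective hinj, hm]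
  have hcomp : (g.comp h).map φ = (gc.roots.map fun b => hc - C b).prod := by
    rw [map_comp, ← hgc, ← hhc]
    conv_lhs => rw [hgprod]
    rw [multiset_prod_comp, Multiset.map_map]
    simp
  have hM : ((g.comp h).map φ).mahlerMeasure =
      (gc.roots.map fun b => (hc - C b).mahlerMeasure).prod := by
    rw [hcomp, prod_mahlerMeasure_eq_mahlerMeasure_prod, Multiset.map_map]
    rfl
  have hMle : ((g.comp h).map φ).mahlerMeasure ≤ (d + 1) * H := by
    refine (mahlerMeasure_le_sum_norm_coeff _).trans ?_
    rw [sum_over_range _ (by simp)]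
    have hdeg : ((g.comp h).map φ).natDegree = d := by
      rw [natDegree_map_eq_of_injective hinj, natDegree_comp, hm, hd]
    rw [hdeg]
    refine (Finset.sum_le_card_nsmul _ _ (H : ℝ) ?_).trans ?_
    · intro i _
      rw [coeff_map]
      have := hH i
      simp only [φ, eq_intCast, Complex.norm_intCast]
      exact_mod_cast this
    · simp
  have hcoef : ∀ b i, ‖(hc - C b).coeff i‖ ≤ 2 ^ h.natDegree * (hc - C b).mahlerMeasure := by
    intro b i
    refine (norm_coeff_le_choose_mul_mahlerMeasure i _).trans ?_
    have : (hc - C b).natDegree = h.natDegree := by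
      rw [natDegree_sub_C, hhc, natDegree_map_eq_of_injective hinj]
    rw [this]
    gcongr
    · exact mahlerMeasure_nonneg _
    · exact_mod_cast Nat.choose_le_two_pow _ _
  have hmax : ∀ b : ℂ, max (A : ℝ) ‖b‖ ≤ 2 ^ h.natDegree * (hc - C b).mahlerMeasure := by
    intro b
    apply max_le
    · obtain ⟨i, hi, rfl⟩ := hA
      refine le_trans (le_of_eq ?_) (hcoef b i)
      rw [coeff_sub, coeff_C, if_neg hi, sub_zero, hhc, coeff_map]
      simp [φ, Nat.cast_natAbs]
    · refine le_trans (le_of_eq ?_) (hcoef b 0)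
      simp [hhc, coeff_map, hh0]
  have hprod : (gc.roots.map fun b => max (A : ℝ) ‖b‖).prod ≤ 2 ^ d * ((d + 1) * H) := by
    refine (multiset_prod_le_of_le _ _ (fun b => (hc - C b).mahlerMeasure) (2 ^ h.natDegree)
      (fun b => by positivity) hmax).trans ?_
    rw [hcard, ← pow_mul, mul_comm h.natDegree, hd, ← hM]
    gcongr
  constructor
  · have h1 := pow_card_le_prod_max gc.roots (A : ℝ) (by positivity)
    rw [hcard] at h1
    have h2 : (A : ℝ) ^ m ≤ 2 ^ m * 2 ^ d * (d + 1) * H := by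
      have h3 : (1 : ℝ) ≤ 2 ^ m := one_le_pow₀ (by norm_num)
      have h4 : (0 : ℝ) ≤ 2 ^ d * ((d + 1) * H) := by positivity
      nlinarith
    exact_mod_cast h2
  · intro k
    have h1 := coeff_prod_bound gc.roots (A : ℝ) (by positivity) k
    rw [hcard, ← hgprod, hgc, coeff_map, ← hgc] at h1
    have h2 : ((g.coeff k).natAbs : ℝ) * (A : ℝ) ^ k ≤ 2 ^ m * 2 ^ d * (d + 1) * H := by
      have h5 : ‖φ (g.coeff k)‖ = ((g.coeff k).natAbs : ℝ) := by
        simp [φ, Nat.cast_natAbs]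
      rw [h5] at h1
      calc _ ≤ _ := h1
        _ ≤ 2 ^ m * (2 ^ d * ((d + 1) * H)) := by gcongr
        _ = _ := by ring
    exact_mod_cast h2

/-- The height of an integer vector, at least one. -/
def vecHgt {r : ℕ} (a : Fin r → ℤ) : ℕ := max 1 (Finset.univ.sup fun i => (a i).natAbs)

/-- The integer vectors with entries bounded by `B`. -/
noncomputable def vecBox (r B : ℕ) : Finset (Fin r → ℤ) :=
  Fintype.piFinset fun _ : Fin r => Finset.Icc (-(B : ℤ)) (B : ℤ)

/-- The box of possible coefficient vectors of pairs `(h, g)`. -/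
noncomputable def pairBox (r m K B : ℕ) : Finset (Σ _ : Fin r → ℤ, Fin m → ℤ) :=
  ((vecBox r B).filter fun a => vecHgt a ^ m ≤ K).sigma fun a =>
    Fintype.piFinset fun k : Fin m =>
      Finset.Icc (-((K / vecHgt a ^ (k : ℕ) : ℕ) : ℤ)) ((K / vecHgt a ^ (k : ℕ) : ℕ) : ℤ)

lemma one_le_vecHgt {r : ℕ} (a : Fin r → ℤ) : 1 ≤ vecHgt a := le_max_left _ _

lemma natAbs_le_vecHgt {r : ℕ} (a : Fin r → ℤ) (i : Fin r) : (a i).natAbs ≤ vecHgt a :=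
  (Finset.le_sup (f := fun i => (a i).natAbs) (Finset.mem_univ i)).trans (le_max_right _ _)

lemma vecHgt_attained {r : ℕ} (a : Fin r → ℤ) :
    vecHgt a = 1 ∨ ∃ i, (a i).natAbs = vecHgt a := by
  unfold vecHgt
  rcases le_total (Finset.univ.sup fun i => (a i).natAbs) 1 with h | h
  · left; exact max_eq_left h
  · right
    rw [max_eq_right h]
    have hne : (Finset.univ : Finset (Fin r)).Nonempty := by
      by_contra hcon
      rw [Finset.not_nonempty_iff_eq_empty] at hcon
      rw [hcon] at h
      simp at h
    obtain ⟨i, _, hi⟩ := Finset.exists_mem_eq_sup _ hne (fun i => (a i).natAbs)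
    exact ⟨i, hi.symm⟩

lemma pairBox_card (r m K B : ℕ) :
    ((pairBox r m K B).card : ℝ) ≤
      (3 * K : ℝ) ^ m * ∑ a ∈ vecBox r B, 1 / (vecHgt a : ℝ) ^ (∑ k ∈ Finset.range m, k) := by
  unfold pairBox
  rw [Finset.card_sigma, Nat.cast_sum, Finset.mul_sum]
  refine le_trans (Finset.sum_le_sum (g := fun a => (3 * K : ℝ) ^ m *
    (1 / (vecHgt a : ℝ) ^ (∑ k ∈ Finset.range m, k))) ?_) ?_
  · intro a ha
    have haK := (Finset.mem_filter.1 ha).2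
    have hpos : 1 ≤ vecHgt a := one_le_vecHgt a
    have hposR : (1 : ℝ) ≤ vecHgt a := by exact_mod_cast hpos
    rw [Fintype.card_piFinset, Nat.cast_prod]
    have h1 : ∀ k ∈ (Finset.univ : Finset (Fin m)),
        ((Finset.Icc (-((K / vecHgt a ^ (k : ℕ) : ℕ) : ℤ))
          ((K / vecHgt a ^ (k : ℕ) : ℕ) : ℤ)).card : ℝ) ≤ 3 * K / (vecHgt a : ℝ) ^ (k : ℕ) := by
      intro k _
      have hle : vecHgt a ^ (k : ℕ) ≤ K := (Nat.pow_le_pow_right hpos k.2.le).trans haK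
      have hq : 1 ≤ K / vecHgt a ^ (k : ℕ) := by
        rw [Nat.le_div_iff_mul_le (by positivity)]; simpa using hle
      have hq2 : ((K / vecHgt a ^ (k : ℕ) : ℕ) : ℝ) ≤ K / (vecHgt a : ℝ) ^ (k : ℕ) := by
        have := @Nat.cast_div_le ℝ _ _ _ K (vecHgt a ^ (k : ℕ))
        simpa using this
      have hcard : (Finset.Icc (-((K / vecHgt a ^ (k : ℕ) : ℕ) : ℤ))
          ((K / vecHgt a ^ (k : ℕ) : ℕ) : ℤ)).card ≤ 3 * (K / vecHgt a ^ (k : ℕ)) := by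
        rw [Int.card_Icc]; omega
      calc _ ≤ ((3 * (K / vecHgt a ^ (k : ℕ)) : ℕ) : ℝ) := by exact_mod_cast hcard
        _ = 3 * ((K / vecHgt a ^ (k : ℕ) : ℕ) : ℝ) := by push_cast; ring
        _ ≤ 3 * (K / (vecHgt a : ℝ) ^ (k : ℕ)) := by gcongr
        _ = _ := by ring
    refine (Finset.prod_le_prod (fun _ _ => by positivity) h1).trans (le_of_eq ?_)
    rw [Finset.prod_div_distrib, Finset.prod_const, Finset.card_univ, Fintype.card_fin,
      Fin.prod_univ_eq_prod_range (fun k => (vecHgt a : ℝ) ^ k) m, Finset.prod_pow_eq_pow_sum]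
    ring
  · apply Finset.sum_le_sum_of_subset_of_nonneg (Finset.filter_subset _ _)
    intros; positivity

lemma sum_crude (r B s : ℕ) :
    ∑ a ∈ vecBox r B, 1 / (vecHgt a : ℝ) ^ s ≤ (2 * B + 1 : ℝ) ^ r := by
  refine (Finset.sum_le_card_nsmul _ _ 1 ?_).trans ?_
  · intro a _
    have hposR : (1 : ℝ) ≤ vecHgt a := by exact_mod_cast one_le_vecHgt a
    rw [div_le_one (by positivity)]
    exact one_le_pow₀ hposR
  · unfold vecBox
    rw [Fintype.card_piFinset]
    simp only [Int.card_Icc, Finset.prod_const, Finset.card_univ, Fintype.card_fin, nsmul_eq_mul,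
      mul_one]
    have : ((B : ℤ) + 1 - -(B : ℤ)).toNat = 2 * B + 1 := by omega
    rw [this]
    push_cast
    exact le_rfl

lemma sum_refined (r s : ℕ) (hr : 1 ≤ r) (hs : r + 1 ≤ s) :
    ∃ K : ℝ, 0 < K ∧ ∀ B, ∑ a ∈ vecBox r B, 1 / (vecHgt a : ℝ) ^ s ≤ K := by
  set p : ℝ := ((r : ℝ) + 1) / r with hp
  have hr0 : (0 : ℝ) < r := by exact_mod_cast hr
  have hp1 : 1 < p := by rw [hp, lt_div_iff₀ hr0]; linarith
  have hsum := Real.summable_abs_int_rpow hp1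
  set F : ℤ → ℝ := fun k => (max 1 |(k : ℝ)|) ^ (-p) with hF
  set S : ℝ := ∑' k : ℤ, |(k : ℝ)| ^ (-p) with hS
  have hS0 : 0 ≤ S := tsum_nonneg fun k => by positivity
  refine ⟨(1 + S) ^ r, by positivity, fun B => ?_⟩
  have h1 : ∀ k ∈ Finset.Icc (-(B : ℤ)) (B : ℤ),
      F k ≤ (if k = 0 then 1 else 0) + |(k : ℝ)| ^ (-p) := by
    intro k _
    simp only [hF]
    split_ifs with hk
    · subst hk; simp; positivity
    · have : (1 : ℝ) ≤ |(k : ℝ)| := by exact_mod_cast Int.one_le_abs hk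
      rw [max_eq_right this, zero_add]
  have h2 : ∑ k ∈ Finset.Icc (-(B : ℤ)) (B : ℤ), F k ≤ 1 + S := by
    refine (Finset.sum_le_sum h1).trans ?_
    rw [Finset.sum_add_distrib]
    apply add_le_add
    · rw [Finset.sum_ite_eq']; split_ifs <;> norm_num
    · exact hsum.sum_le_tsum _ fun k _ => by positivity
  have h3 : ∀ a ∈ vecBox r B, 1 / (vecHgt a : ℝ) ^ s ≤ ∏ i, F (a i) := by
    intro a _
    have hposR : (1 : ℝ) ≤ vecHgt a := by exact_mod_cast one_le_vecHgt a
    have h4 : ∏ i : Fin r, (vecHgt a : ℝ) ^ (-p) ≤ ∏ i, F (a i) := by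
      apply Finset.prod_le_prod
      · intros; positivity
      · intro i _
        apply Real.rpow_le_rpow_of_nonpos
        · positivity
        · apply max_le hposR
          have := natAbs_le_vecHgt a i
          have h5 : ((a i).natAbs : ℝ) ≤ vecHgt a := by exact_mod_cast this
          rwa [Nat.cast_natAbs, Int.cast_abs] at h5
        · linarith
    refine le_trans ?_ h4
    rw [Finset.prod_const, Finset.card_univ, Fintype.card_fin, ← Real.rpow_natCast,
      ← Real.rpow_natCast, ← Real.rpow_mul (by positivity), one_div, ← Real.rpow_neg (by positivity)]
    apply Real.rpow_le_rpow_of_exponent_le hposR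
    have : -p * r = -((r : ℝ) + 1) := by rw [hp]; field_simp
    rw [this]
    have : ((r : ℝ) + 1) ≤ s := by exact_mod_cast hs
    linarith
  refine (Finset.sum_le_sum h3).trans ?_
  unfold vecBox
  rw [← Finset.prod_univ_sum (fun _ => Finset.Icc (-(B : ℤ)) (B : ℤ)) (fun _ k => F k), Finset.prod_const, Finset.card_univ, Fintype.card_fin]
  apply pow_le_pow_left₀ _ h2
  exact Finset.sum_nonneg fun k _ => by positivity

/-- Decomposable polynomials with a normalized decomposition with left degree `m`. -/
def PM (d m H : ℕ) : Set ℤ[X] :=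
  {f | HeightLe f H ∧ ∃ g h : ℤ[X], g.Monic ∧ h.Monic ∧ g.natDegree = m ∧ m * h.natDegree = d ∧
    h.coeff 0 = 0 ∧ f = g.comp h}

lemma monic_ext {p q : ℤ[X]} {n : ℕ} (hp : p.Monic) (hq : q.Monic) (hpn : p.natDegree = n)
    (hqn : q.natDegree = n) (h : ∀ i < n, p.coeff i = q.coeff i) : p = q := by
  ext i
  rcases lt_trichotomy i n with hi | hi | hi
  · exact h i hi
  · subst hi
    rw [← hpn, hp.coeff_natDegree, hpn, ← hqn, hq.coeff_natDegree]
  · rw [coeff_eq_zero_of_natDegree_lt (by omega), coeff_eq_zero_of_natDegree_lt (by omega)]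

lemma PM_bound (d m n H B : ℕ) (hm : 0 < m) (hn : 2 ≤ n) (hmn : m * n = d)
    (hB : ∀ x, x ^ m ≤ 2 ^ m * 2 ^ d * (d + 1) * H → x ≤ B) :
    (PM d m H).Finite ∧
      (PM d m H).ncard ≤ (pairBox (n - 1) m (2 ^ m * 2 ^ d * (d + 1) * H) B).card := by
  classical
  have hch : ∀ f : ℤ[X], ∃ gh : ℤ[X] × ℤ[X], f ∈ PM d m H → gh.1.Monic ∧ gh.2.Monic ∧
      gh.1.natDegree = m ∧ gh.2.natDegree = n ∧ gh.2.coeff 0 = 0 ∧ f = gh.1.comp gh.2 := by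
    intro f
    by_cases hf : f ∈ PM d m H
    · obtain ⟨_, g, h, h1, h2, h3, h4, h5, h6⟩ := hf
      refine ⟨(g, h), fun _ => ⟨h1, h2, h3, ?_, h5, h6⟩⟩
      exact Nat.eq_of_mul_eq_mul_left hm (h4.trans hmn.symm)
    · exact ⟨(0, 0), fun h => absurd h hf⟩
  choose gh hgh using hch
  let Φ : ℤ[X] → (Σ _ : Fin (n - 1) → ℤ, Fin m → ℤ) := fun f =>
    ⟨fun i => (gh f).2.coeff (i + 1), fun k => (gh f).1.coeff k⟩
  have hinj : Set.InjOn Φ (PM d m H) := by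
    intro f hf f' hf' hEq
    obtain ⟨h1, h2, h3, h4, h5, h6⟩ := hgh f hf
    obtain ⟨h1', h2', h3', h4', h5', h6'⟩ := hgh f' hf'
    simp only [Φ, Sigma.mk.injEq, heq_eq_eq] at hEq
    obtain ⟨e1, e2⟩ := hEq
    have eg : (gh f).1 = (gh f').1 :=
      monic_ext h1 h1' h3 h3' fun i hi => congrFun e2 ⟨i, hi⟩
    have eh : (gh f).2 = (gh f').2 := by
      refine monic_ext h2 h2' h4 h4' fun i hi => ?_
      rcases i with _ | i
      · rw [h5, h5']
      · exact congrFun e1 ⟨i, by omega⟩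
    rw [h6, h6', eg, eh]
  have hmaps : ∀ f ∈ PM d m H, Φ f ∈
      ((pairBox (n - 1) m (2 ^ m * 2 ^ d * (d + 1) * H) B : Finset _) : Set _) := by
    intro f hf
    obtain ⟨h1, h2, h3, h4, h5, h6⟩ := hgh f hf
    have hH := hf.1
    rw [h6] at hH
    set a : Fin (n - 1) → ℤ := fun i => (gh f).2.coeff (i + 1) with ha
    have hatt : ∃ i, i ≠ 0 ∧ ((gh f).2.coeff i).natAbs = vecHgt a := by
      rcases vecHgt_attained a with h | ⟨i, hi⟩
      · refine ⟨n, by omega, ?_⟩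
        rw [h, ← h4, h2.coeff_natDegree]; rfl
      · exact ⟨i + 1, by omega, hi⟩
    obtain ⟨k1, k2⟩ := key_bound _ _ h1 h5 H _ hatt hH m d h3 (by rw [h4, hmn])
    have hAB := hB _ k1
    simp only [pairBox, Finset.mem_coe, Finset.mem_sigma, Finset.mem_filter, vecBox,
      Fintype.mem_piFinset, Finset.mem_Icc, Φ]
    refine ⟨⟨fun i => ?_, k1⟩, fun k => ?_⟩
    · have := (natAbs_le_vecHgt a i).trans hAB
      simp only [ha] at this
      omega
    · have := (Nat.le_div_iff_mul_le (pow_pos (one_le_vecHgt a) _)).2 (k2 k)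
      simp only [ha] at this
      omega
  refine ⟨Set.Finite.of_injOn hmaps hinj (Finset.finite_toSet _), ?_⟩
  have := Set.ncard_le_ncard_of_injOn Φ hmaps hinj (Finset.finite_toSet _)
  rwa [Set.ncard_coe_finset] at this

lemma PM_asymp (d m n : ℕ) (hd : 6 ≤ d) (hm : 2 ≤ m) (hn : 2 ≤ n) (hmn : m * n = d) :
    ∃ c : ℝ, 0 < c ∧ ∀ H : ℕ, 2 ≤ H → (PM d m H).Finite ∧
      ((PM d m H).ncard : ℝ) ≤ c * (H : ℝ) ^ (d / d.minFac) := by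
  set C₀ : ℕ := 2 ^ m * 2 ^ d * (d + 1) with hC₀
  have hCpos : 0 < C₀ := by positivity
  have hlm : d.minFac ≤ m := Nat.minFac_le_of_dvd hm ⟨n, hmn.symm⟩
  have hln : d.minFac ≤ n := Nat.minFac_le_of_dvd hn ⟨m, by rw [mul_comm, hmn]⟩
  have hl2 : 2 ≤ d.minFac := (Nat.minFac_prime (by omega)).two_le
  have hNl : d.minFac * (d / d.minFac) = d := Nat.mul_div_cancel' (Nat.minFac_dvd d)
  set l := d.minFac
  set N := d / l
  rcases eq_or_ne n l with hnl | hnl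
  · have hNm : N = m := by
      have : l * N = l * m := by rw [hNl, ← hmn, hnl, mul_comm]
      exact Nat.eq_of_mul_eq_mul_left (by omega) this
    have hm3 : 3 ≤ m := by
      by_contra hcon
      have : m = 2 := by omega
      have : n = 2 := by omega
      have h6 : m * n = 4 := by rw [‹m = 2›, ‹n = 2›]
      omega
    have hs : (n - 1) + 1 ≤ ∑ k ∈ Finset.range m, k := by
      have h1 := Finset.sum_range_id_mul_two m
      have h2 : m * 2 ≤ m * (m - 1) := Nat.mul_le_mul_left _ (by omega)
      omega
    obtain ⟨K, hK, hsum⟩ := sum_refined (n - 1) _ (by omega) hs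
    refine ⟨(3 * C₀ : ℝ) ^ m * K, by positivity, fun H hH => ?_⟩
    obtain ⟨hfin, hle⟩ := PM_bound d m n H (C₀ * H) (by omega) hn hmn
      (fun x hx => (Nat.le_self_pow (by omega) x).trans hx)
    refine ⟨hfin, ?_⟩
    rw [← hC₀] at hle
    calc ((PM d m H).ncard : ℝ) ≤ ((pairBox (n - 1) m (C₀ * H) (C₀ * H)).card : ℝ) := by
          exact_mod_cast hle
      _ ≤ _ := pairBox_card _ _ _ _
      _ ≤ (3 * ((C₀ * H : ℕ) : ℝ)) ^ m * K := by gcongr; exact hsum _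
      _ = _ := by rw [hNm]; push_cast; ring
  · have hlt : l < n := by omega
    have hNm : m < N := by
      have h1 : l * m < l * N := by
        rw [hNl, ← hmn, mul_comm]; exact Nat.mul_lt_mul_of_pos_left hlt (by omega)
      exact Nat.lt_of_mul_lt_mul_left h1
    have hNn : n ≤ N := by
      have h1 : l * n ≤ l * N := by
        rw [hNl, ← hmn]; exact Nat.mul_le_mul_right _ hlm
      exact Nat.le_of_mul_le_mul_left h1 (by omega)
    have hexp : n - 1 ≤ m * (N - m) := by
      obtain ⟨t, ht⟩ : ∃ t, N = m + 1 + t := ⟨N - (m + 1), by omega⟩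
      have : N - m = 1 + t := by omega
      rw [this]
      nlinarith [Nat.zero_le t, Nat.mul_le_mul_right t (show 1 ≤ m by omega), show n - 1 ≤ m + t by omega]
    refine ⟨(3 * C₀ : ℝ) ^ m * (3 ^ (n - 1) * (C₀ : ℝ) ^ (N - m)), by positivity, fun H hH => ?_⟩
    set K := C₀ * H with hKdef
    have hK1 : 1 ≤ K := Nat.mul_pos hCpos (by omega)
    set B := Nat.findGreatest (fun x => x ^ m ≤ K) K with hBdef
    have hB1 : 1 ≤ B := Nat.le_findGreatest hK1 (by simpa using hK1)
    have hBm : B ^ m ≤ K := Nat.findGreatest_spec (P := fun x => x ^ m ≤ K) hK1 (by simpa using hK1)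
    obtain ⟨hfin, hle⟩ := PM_bound d m n H B (by omega) hn hmn
      (fun x hx => Nat.le_findGreatest ((Nat.le_self_pow (by omega) x).trans hx) hx)
    refine ⟨hfin, ?_⟩
    rw [← hC₀, ← hKdef] at hle
    have hBn : (2 * B + 1) ^ (n - 1) ≤ 3 ^ (n - 1) * K ^ (N - m) := by
      calc (2 * B + 1) ^ (n - 1) ≤ (3 * B) ^ (n - 1) := Nat.pow_le_pow_left (by omega) _
        _ = 3 ^ (n - 1) * B ^ (n - 1) := mul_pow _ _ _
        _ ≤ 3 ^ (n - 1) * B ^ (m * (N - m)) :=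
            Nat.mul_le_mul_left _ (Nat.pow_le_pow_right hB1 hexp)
        _ = 3 ^ (n - 1) * (B ^ m) ^ (N - m) := by rw [pow_mul]
        _ ≤ _ := Nat.mul_le_mul_left _ (Nat.pow_le_pow_left hBm _)
    have hBnR : (2 * (B : ℝ) + 1) ^ (n - 1) ≤ 3 ^ (n - 1) * (K : ℝ) ^ (N - m) := by
      exact_mod_cast hBn
    calc ((PM d m H).ncard : ℝ) ≤ ((pairBox (n - 1) m K B).card : ℝ) := by
          exact_mod_cast hle
      _ ≤ _ := pairBox_card _ _ _ _
      _ ≤ (3 * (K : ℝ)) ^ m * (3 ^ (n - 1) * (K : ℝ) ^ (N - m)) := by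
          gcongr; exact (sum_crude _ _ _).trans hBnR
      _ = _ := by
          have : (H : ℝ) ^ N = (H : ℝ) ^ m * (H : ℝ) ^ (N - m) := by
            rw [← pow_add]; congr 1; omega
          rw [this, hKdef]; push_cast
          simp only [mul_pow]
          ring

/-- The set counted by `DdMonic`. -/
def decompSet (d H : ℕ) : Set ℤ[X] := {f | f.Monic ∧ f.natDegree = d ∧ HeightLe f H ∧ Decomposable f}

lemma DdMonic_eq (d H : ℕ) : DdMonic d H = (decompSet d H).ncard := rfl

/-- The monic polynomial with given lower coefficients. -/
noncomputable def mkPoly (N : ℕ) (b : Fin N → ℤ) : ℤ[X] :=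
  X ^ N + ∑ i : Fin N, C (b i) * X ^ (i : ℕ)

lemma mkPoly_monic (N : ℕ) (b : Fin N → ℤ) : (mkPoly N b).Monic :=
  monic_X_pow_add (degree_sum_fin_lt b)

lemma mkPoly_natDegree (N : ℕ) (b : Fin N → ℤ) : (mkPoly N b).natDegree = N := by
  apply natDegree_eq_of_degree_eq_some
  unfold mkPoly
  rw [degree_add_eq_left_of_degree_lt, degree_X_pow]
  rw [degree_X_pow]
  exact degree_sum_fin_lt b

lemma mkPoly_coeff (N : ℕ) (b : Fin N → ℤ) (i : Fin N) : (mkPoly N b).coeff i = b i := by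
  unfold mkPoly
  rw [coeff_add, coeff_X_pow, if_neg (by have := i.2; omega), zero_add, finsetSum_coeff,
    Finset.sum_eq_single i]
  · simp
  · intro j _ hj
    rw [coeff_C_mul_X_pow, if_neg]
    intro h; exact hj (Fin.ext h.symm)
  · simp

lemma lower_bound (d H l N : ℕ) (hl : 2 ≤ l) (hN : 2 ≤ N) (hlN : l * N = d) (hH : 2 ≤ H)
    (hfin : (decompSet d H).Finite) : H ^ N ≤ (decompSet d H).ncard := by
  have h1 : ((vecBox N H : Finset _) : Set (Fin N → ℤ)).ncard ≤ (decompSet d H).ncard := by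
    apply Set.ncard_le_ncard_of_injOn (fun b => expand ℤ l (mkPoly N b)) _ _ hfin
    · intro b hb
      have hb' : ∀ i, -(H : ℤ) ≤ b i ∧ b i ≤ H := by
        intro i
        exact Finset.mem_Icc.1 (Fintype.mem_piFinset.1 (Finset.mem_coe.1 hb) i)
      refine ⟨(mkPoly_monic N b).expand (by omega), ?_, ?_, mkPoly N b, X ^ l, ?_, ?_, ?_⟩
      · rw [natDegree_expand, mkPoly_natDegree, mul_comm, hlN]
      · intro i
        simp only [coeff_expand (show 0 < l by omega)]
        split_ifs
        · rcases lt_trichotomy (i / l) N with h | h | h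
          · have := mkPoly_coeff N b ⟨i / l, h⟩
            simp only at this
            rw [this, abs_le]
            exact hb' _
          · have h2 := (mkPoly_monic N b).coeff_natDegree
            rw [mkPoly_natDegree] at h2
            rw [h, h2, abs_one]; omega
          · rw [coeff_eq_zero_of_natDegree_lt (by rw [mkPoly_natDegree]; exact h)]
            simp
        · simp
      · rw [mkPoly_natDegree]; exact hN
      · rw [natDegree_X_pow]; exact hl
      · exact expand_eq_comp_X_pow l
    · intro b _ b' _ h
      have h2 := expand_injective (R := ℤ) (show 0 < l by omega) h
      funext i
      rw [← mkPoly_coeff N b i, h2, mkPoly_coeff]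
  rw [Set.ncard_coe_finset] at h1
  refine le_trans ?_ h1
  unfold vecBox
  rw [Fintype.card_piFinset]
  simp only [Int.card_Icc, Finset.prod_const, Finset.card_univ, Fintype.card_fin]
  exact Nat.pow_le_pow_left (by omega) _

theorem stmt_5 (d : ℕ) (hd : 6 ≤ d) (hcomp : ¬ Nat.Prime d) :
    ∃ c₁ c₂ : ℝ, 0 < c₁ ∧ 0 < c₂ ∧ ∀ H : ℕ, 2 ≤ H →
      c₁ * (H : ℝ) ^ (d / d.minFac) ≤ (DdMonic d H : ℝ) ∧
      (DdMonic d H : ℝ) ≤ c₂ * (H : ℝ) ^ (d / d.minFac) := by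
  classical
  set M : Finset ℕ := (Finset.range (d + 1)).filter fun m => 2 ≤ m ∧ ∃ n, 2 ≤ n ∧ m * n = d with hM
  have hex : ∀ m, ∃ c : ℝ, 0 < c ∧ (m ∈ M → ∀ H : ℕ, 2 ≤ H → (PM d m H).Finite ∧
      ((PM d m H).ncard : ℝ) ≤ c * (H : ℝ) ^ (d / d.minFac)) := by
    intro m
    by_cases hm : m ∈ M
    · obtain ⟨_, h2, n, hn, hmn⟩ := Finset.mem_filter.1 hm
      obtain ⟨c, hc, h⟩ := PM_asymp d m n hd h2 hn hmn
      exact ⟨c, hc, fun _ => h⟩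
    · exact ⟨1, one_pos, fun h => absurd h hm⟩
  choose c hc hbound using hex
  have hsub : ∀ H, decompSet d H ⊆ ⋃ m ∈ M, PM d m H := by
    intro H f ⟨hf1, hf2, hf3, hf4⟩
    obtain ⟨g, h, hg, hh, hg2, hh2, h0, rfl⟩ := normalize_decomp f hf1 hf4
    rw [natDegree_comp] at hf2
    have hmem : g.natDegree ∈ M := by
      refine Finset.mem_filter.2 ⟨?_, hg2, h.natDegree, hh2, hf2⟩
      rw [Finset.mem_range]
      nlinarith
    exact Set.mem_biUnion hmem ⟨hf3, g, h, hg, hh, rfl, hf2, h0, rfl⟩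
  refine ⟨1, 1 + ∑ m ∈ M, c m, one_pos, ?_, fun H hH => ?_⟩
  · have : 0 ≤ ∑ m ∈ M, c m := Finset.sum_nonneg fun m _ => (hc m).le
    linarith
  have hfinU : (⋃ m ∈ M, PM d m H).Finite :=
    M.finite_toSet.biUnion fun m hm => (hbound m hm H hH).1
  have hfin : (decompSet d H).Finite := hfinU.subset (hsub H)
  rw [DdMonic_eq]
  constructor
  · have hl2 : 2 ≤ d.minFac := (Nat.minFac_prime (by omega)).two_le
    have hNl : d.minFac * (d / d.minFac) = d := Nat.mul_div_cancel' (Nat.minFac_dvd d)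
    have hN : 2 ≤ d / d.minFac := by
      have h1 := Nat.minFac_le_div (by omega) hcomp
      omega
    have := lower_bound d H _ _ hl2 hN hNl hH hfin
    rw [one_mul]
    exact_mod_cast this
  · have h1 : (decompSet d H).ncard ≤ ∑ m ∈ M, (PM d m H).ncard :=
      (Set.ncard_le_ncard (hsub H) hfinU).trans (M.set_ncard_biUnion_le _)
    calc ((decompSet d H).ncard : ℝ) ≤ ∑ m ∈ M, ((PM d m H).ncard : ℝ) := by exact_mod_cast h1
      _ ≤ ∑ m ∈ M, c m * (H : ℝ) ^ (d / d.minFac) :=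
          Finset.sum_le_sum fun m hm => (hbound m hm H hH).2
      _ = (∑ m ∈ M, c m) * (H : ℝ) ^ (d / d.minFac) := by rw [Finset.sum_mul]
      _ ≤ _ := mul_le_mul_of_nonneg_right (by linarith) (by positivity)
end

section
/- Let d ≥ 4 be a composite integer with d ≠ 6, and let ℓ be the smallest prime factor of d. Then there exists a constant c > 0 (depending only on d) such that for all integers H ≥ 2, |D_d(H) - I_d(H)| ≤ c·H^{d/ℓ - 1}. -/
open Polynomial

/-- `IdMonic d e H` is the number of monic integer polynomials of degree `d` and height at
most `H` which are compositions `g ∘ h` of indecomposable polynomials with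
`deg g = d / e` and `deg h = e`. -/
noncomputable def IdMonic (d e : ℕ) (H : ℕ) : ℕ :=
  Nat.card {f : ℤ[X] // f.Monic ∧ f.natDegree = d ∧ HeightLe f H ∧
    ∃ g h : ℤ[X], ¬ Decomposable g ∧ ¬ Decomposable h ∧
      g.natDegree = d / e ∧ h.natDegree = e ∧ f = g.comp h}


/-- Normalisation of a decomposition of a monic polynomial. -/
lemma normalize_decomp_s7 (f g h : ℤ[X]) (hf : f.Monic) (hg : 1 ≤ g.natDegree)
    (hh : 1 ≤ h.natDegree) (hfgh : f = g.comp h) :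
    ∃ g' h' : ℤ[X], g'.Monic ∧ h'.Monic ∧ g'.natDegree = g.natDegree ∧
      h'.natDegree = h.natDegree ∧ h'.coeff 0 = 0 ∧ f = g'.comp h' := by
  have h1 : g.leadingCoeff * h.leadingCoeff ^ g.natDegree = 1 := by
    rw [← leadingCoeff_comp (by omega), ← hfgh]; exact hf
  have hu : IsUnit h.leadingCoeff := by
    have h2 : IsUnit (h.leadingCoeff ^ g.natDegree) := IsUnit.of_mul_eq_one_right _ h1
    exact (isUnit_pow_iff (by omega)).1 h2
  have hu2 : h.leadingCoeff * h.leadingCoeff = 1 := by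
    rcases Int.isUnit_iff.1 hu with h | h <;> rw [h] <;> norm_num
  have hu0 : h.leadingCoeff ≠ 0 := hu.ne_zero
  set u := h.leadingCoeff with hudef
  have hd0 : (h - C (h.coeff 0)).natDegree = h.natDegree := natDegree_sub_C
  have hd1 : (C u * (h - C (h.coeff 0))).natDegree = h.natDegree := by
    rw [natDegree_C_mul hu0, hd0]
  have hm1 : (C u * (h - C (h.coeff 0))).Monic := by
    rw [Monic, leadingCoeff, hd1, coeff_C_mul, coeff_sub, coeff_C, if_neg (by omega), sub_zero]
    exact hu2
  have hc : (g.comp (C u * X + C (h.coeff 0))).comp (C u * (h - C (h.coeff 0))) = f := by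
    rw [comp_assoc, hfgh]
    congr 1
    simp only [add_comp, mul_comp, C_comp, X_comp]
    rw [← mul_assoc, ← C_mul, hu2]
    simp
  refine ⟨g.comp (C u * X + C (h.coeff 0)), C u * (h - C (h.coeff 0)), ?_, hm1, ?_, hd1, ?_,
    hc.symm⟩
  · have := leadingCoeff_comp (p := g.comp (C u * X + C (h.coeff 0)))
      (q := C u * (h - C (h.coeff 0))) (by omega)
    rw [hc, hm1.leadingCoeff, hf.leadingCoeff] at this
    rw [Monic]; simpa using this.symm
  · rw [natDegree_comp, natDegree_linear hu0, mul_one]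
  · simp

/-- Mahler measure of an integer polynomial. -/
noncomputable def mm (p : ℤ[X]) : ℝ := (p.map (Int.castRingHom ℂ)).mahlerMeasure

lemma mm_mul (p q : ℤ[X]) : mm (p * q) = mm p * mm q := by
  simp [mm, Polynomial.map_mul, mahlerMeasure_mul]

lemma coeff_le_mm (d : ℕ) (p : ℤ[X]) (hp : p.natDegree ≤ d) (i : ℕ) :
    |(p.coeff i : ℝ)| ≤ 2 ^ d * mm p := by
  have h1 := norm_coeff_le_choose_mul_mahlerMeasure i (p.map (Int.castRingHom ℂ))
  rw [coeff_map] at h1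
  have h2 : ‖(Int.castRingHom ℂ) (p.coeff i)‖ = |(p.coeff i : ℝ)| := by
    simp [Complex.norm_intCast]
  rw [h2] at h1
  refine h1.trans ?_
  unfold mm
  have h3 : (p.map (Int.castRingHom ℂ)).natDegree ≤ d := natDegree_map_le.trans hp
  have h4 : (((p.map (Int.castRingHom ℂ)).natDegree.choose i : ℕ) : ℝ) ≤ 2 ^ d := by
    have : (p.map (Int.castRingHom ℂ)).natDegree.choose i ≤ 2 ^ d :=
      (Nat.choose_le_two_pow _ _).trans (Nat.pow_le_pow_right (by norm_num) h3)
    exact_mod_cast this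
  exact mul_le_mul_of_nonneg_right h4 (mahlerMeasure_nonneg _)

lemma mm_le (d : ℕ) (p : ℤ[X]) (hp : p.natDegree ≤ d) (A : ℝ)
    (hA : ∀ i, |(p.coeff i : ℝ)| ≤ A) : mm p ≤ (d + 1) * A := by
  have h1 := mahlerMeasure_le_sum_norm_coeff (p.map (Int.castRingHom ℂ))
  have h3 : (p.map (Int.castRingHom ℂ)).natDegree < d + 1 :=
    Nat.lt_succ_of_le (natDegree_map_le.trans hp)
  rw [sum_over_range' _ (by simp) (d + 1) h3] at h1
  refine h1.trans ?_
  calc _ ≤ ∑ _i ∈ Finset.range (d + 1), A := by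
        apply Finset.sum_le_sum
        intro i _
        rw [coeff_map]
        simpa [Complex.norm_intCast] using hA i
    _ = _ := by simp

lemma one_le_mm (p : ℤ[X]) (hp : p ≠ 0) : 1 ≤ mm p := one_le_mahlerMeasure_of_ne_zero hp

lemma coeff_bound (d : ℕ) (h : ℤ[X]) (hh : h ≠ 0) (h0 : h.coeff 0 = 0) (i : ℕ) :
    ∀ (g : ℤ[X]) (A : ℝ), (g.natDegree * h.natDegree ≤ d) →
    (∀ i, |((g.comp h).coeff i : ℝ)| ≤ A) →
    |(g.coeff i : ℝ)| * mm h ^ i ≤ (2 ^ d * (d + 1)) ^ i * A := by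
  induction i with
  | zero =>
    intro g A hd hA
    have : (g.comp h).coeff 0 = g.coeff 0 := by
      rw [coeff_zero_eq_eval_zero, eval_comp, ← coeff_zero_eq_eval_zero h, h0,
        coeff_zero_eq_eval_zero]
    simpa [this] using hA 0
  | succ i ih =>
    intro g A hd hA
    have hM := one_le_mm h hh
    have hA0 : 0 ≤ A := (abs_nonneg _).trans (hA 0)
    have hc0 : (g.comp h).coeff 0 = g.coeff 0 := by
      rw [coeff_zero_eq_eval_zero, eval_comp, ← coeff_zero_eq_eval_zero h, h0,
        coeff_zero_eq_eval_zero]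
    have e1 : g.comp h = g.divX.comp h * h + C (g.coeff 0) := by
      conv_lhs => rw [← divX_mul_X_add g]
      simp
    have e2 : g.divX.comp h * h = g.comp h - C (g.coeff 0) := by rw [e1]; ring
    have hdX : g.divX.natDegree * h.natDegree ≤ d := by
      refine le_trans (Nat.mul_le_mul_right _ ?_) hd
      rw [natDegree_divX_eq_natDegree_tsub_one]; omega
    have h5 : mm (g.divX.comp h * h) ≤ (d + 1) * A := by
      apply mm_le
      · rw [e2, natDegree_sub_C, natDegree_comp]; exact hd
      · intro k
        rw [e2]
        rcases Nat.eq_zero_or_pos k with rfl | hk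
        · simp [hc0, hA0]
        · rw [coeff_sub, coeff_C, if_neg (by omega), sub_zero]; exact hA k
    rw [mm_mul] at h5
    have hMpos : 0 < mm h := by linarith
    have h6 : mm (g.divX.comp h) ≤ (d + 1) * A / mm h := by
      rw [le_div_iff₀ hMpos]; exact h5
    have h7 := ih g.divX (2 ^ d * ((d + 1) * A / mm h)) hdX (by
      intro k
      refine (coeff_le_mm d _ (by rw [natDegree_comp]; exact hdX) k).trans ?_
      gcongr)
    rw [coeff_divX] at h7
    calc |(g.coeff (i + 1) : ℝ)| * mm h ^ (i + 1)
        = (|(g.coeff (i + 1) : ℝ)| * mm h ^ i) * mm h := by ring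
      _ ≤ ((2 ^ d * (d + 1)) ^ i * (2 ^ d * ((d + 1) * A / mm h))) * mm h := by gcongr
      _ = _ := by field_simp; ring

lemma card_a (m M B : ℕ) (hm : 2 ≤ m) (hB : 1 ≤ B) (hBM : B ≤ M) :
    ∃ S : Finset ℤ[X], S.card * B ≤ (3 * M) ^ m ∧ ∀ g : ℤ[X], g.Monic → g.natDegree = m →
      (∀ i, |g.coeff i| ≤ M) → |g.coeff 1| * B ≤ M → g ∈ S := by
  classical
  let A : Fin (m + 1) → Finset ℤ := fun i =>
    if (i : ℕ) = m then {1} else if (i : ℕ) = 1 then Finset.Icc (-((M / B : ℕ) : ℤ)) ((M / B : ℕ) : ℤ)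
      else Finset.Icc (-(M : ℤ)) M
  refine ⟨(Fintype.piFinset A).image (fun a => ofFn (m + 1) a), ?_, ?_⟩
  · have h1 : ∏ i : Fin (m + 1), ((A i).card * (if (i : ℕ) = 1 then B else 1)) ≤
        ∏ i : Fin (m + 1), (if (i : ℕ) = m then 1 else 3 * M) := by
      apply Finset.prod_le_prod'
      intro i _
      have h2 : 1 ≤ M / B := (Nat.one_le_div_iff hB).2 hBM
      have h3 : M / B * B ≤ M := Nat.div_mul_le_self M B
      simp only [A]
      by_cases hi : (i : ℕ) = m
      · have : m ≠ 1 := by omega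
        simp [hi, this]
      · by_cases hi1 : (i : ℕ) = 1
        · have h4 : (1 : ℕ) ≠ m := by omega
          simp only [hi1, h4, if_true, if_false, Int.card_Icc]
          calc _ ≤ (3 * (M / B)) * B := by
                apply Nat.mul_le_mul_right; omega
            _ ≤ _ := by nlinarith
        · simp only [hi, hi1, if_false, Int.card_Icc]
          omega
    rw [Finset.prod_mul_distrib, ← Finset.prod_range (fun i => if i = 1 then B else 1),
      Finset.prod_ite_eq', ← Finset.prod_range (fun i => if i = m then 1 else 3 * M),
      Finset.prod_range_succ, if_pos (Finset.mem_range.2 (by omega))] at h1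
    have h5 : ∏ x ∈ Finset.range m, (if x = m then 1 else 3 * M) = (3 * M) ^ m := by
      rw [Finset.prod_congr rfl (g := fun _ => 3 * M)]
      · simp
      · intro x hx
        rw [if_neg]; have := Finset.mem_range.1 hx; omega
    rw [h5, if_pos rfl, mul_one] at h1
    refine le_trans (Nat.mul_le_mul_right _ (Finset.card_image_le.trans ?_)) h1
    rw [Fintype.card_piFinset]
  · intro g hg hd hc h1
    refine Finset.mem_image.2 ⟨toFn (m + 1) g, ?_, ?_⟩
    · rw [Fintype.mem_piFinset]
      intro i
      simp only [A, toFn, LinearMap.pi_apply, lcoeff_apply]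
      by_cases hi : (i : ℕ) = m
      · simp [hi, ← hd, hg]
      · by_cases hi1 : (i : ℕ) = 1
        · have h4 : (1 : ℕ) ≠ m := by omega
          simp only [hi1, h4, if_true, if_false, Finset.mem_Icc]
          rw [← abs_le]
          push_cast
          rw [Int.le_ediv_iff_mul_le (by exact_mod_cast hB)]
          exact h1
        · simp only [hi, hi1, if_false, Finset.mem_Icc]
          rw [← abs_le]; exact hc i
    · exact ofFn_comp_toFn_eq_id_of_natDegree_lt (by omega)

lemma card_b (e j B : ℕ) (hj : 1 ≤ j) (hje : j < e) (hB : 1 ≤ B) :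
    ∃ S : Finset ℤ[X], S.card * B ^ 3 ≤ (3 * B) ^ (e + 1) ∧ ∀ h : ℤ[X], h.Monic →
      h.natDegree = e → h.coeff 0 = 0 →
      (∀ i, |h.coeff i| ≤ B) → (|h.coeff j| = B ∨ h.coeff j = 0) → h ∈ S := by
  classical
  let A : Fin (e + 1) → Finset ℤ := fun i =>
    if (i : ℕ) = e then {1} else if (i : ℕ) = 0 then {0} else if (i : ℕ) = j then
      {-(B : ℤ), 0, (B : ℤ)} else Finset.Icc (-(B : ℤ)) B
  refine ⟨(Fintype.piFinset A).image (fun a => ofFn (e + 1) a), ?_, ?_⟩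
  · have h1 : ∏ i : Fin (e + 1), ((A i).card * ((if (i : ℕ) = 0 then B else 1) *
        (if (i : ℕ) = j then B else 1) * (if (i : ℕ) = e then B else 1))) ≤
        ∏ i : Fin (e + 1), (3 * B) := by
      apply Finset.prod_le_prod'
      intro i _
      simp only [A]
      by_cases hi : (i : ℕ) = e
      · have h2 : e ≠ 0 := by omega
        have h3 : e ≠ j := by omega
        simp [hi, h2, h3]; omega
      · by_cases hi1 : (i : ℕ) = 0
        · have h2 : 0 ≠ e := by omega
          have h3 : 0 ≠ j := by omega
          simp [hi1, h2, h3]; omega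
        · by_cases hi2 : (i : ℕ) = j
          · have h2 : j ≠ e := by omega
            have h3 : j ≠ 0 := by omega
            simp only [hi2, h2, h3, if_true, if_false, one_mul, mul_one]
            exact Nat.mul_le_mul_right _ Finset.card_le_three
          · simp only [hi, hi1, hi2, if_false, Int.card_Icc]
            omega
    rw [Finset.prod_mul_distrib, Finset.prod_mul_distrib, Finset.prod_mul_distrib,
      ← Finset.prod_range (fun i => if i = 0 then B else 1),
      ← Finset.prod_range (fun i => if i = j then B else 1),
      ← Finset.prod_range (fun i => if i = e then B else 1),
      Finset.prod_ite_eq', Finset.prod_ite_eq', Finset.prod_ite_eq',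
      if_pos (Finset.mem_range.2 (by omega)), if_pos (Finset.mem_range.2 (by omega)),
      if_pos (Finset.mem_range.2 (by omega))] at h1
    simp only [Finset.prod_const, Finset.card_univ, Fintype.card_fin] at h1
    rw [show B * B * B = B ^ 3 by ring] at h1
    refine le_trans (Nat.mul_le_mul_right _ (Finset.card_image_le.trans ?_)) h1
    rw [Fintype.card_piFinset]
  · intro h hh hd h0 hc h1
    refine Finset.mem_image.2 ⟨toFn (e + 1) h, ?_, ?_⟩
    · rw [Fintype.mem_piFinset]
      intro i
      simp only [A, toFn, LinearMap.pi_apply, lcoeff_apply]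
      by_cases hi : (i : ℕ) = e
      · simp [hi, ← hd, hh]
      · by_cases hi1 : (i : ℕ) = 0
        · have h2 : 0 ≠ e := by omega
          simp [hi1, h2, h0]
        · by_cases hi2 : (i : ℕ) = j
          · have h2 : j ≠ e := by omega
            have h3 : j ≠ 0 := by omega
            simp only [hi2, h2, h3, if_true, if_false, Finset.mem_insert, Finset.mem_singleton]
            rcases h1 with h1 | h1
            · rcases abs_choice (h.coeff j) with h4 | h4 <;> omega
            · omega
          · simp only [hi, hi1, hi2, if_false, Finset.mem_Icc]
            rw [← abs_le]; exact hc i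
    · exact ofFn_comp_toFn_eq_id_of_natDegree_lt (by omega)

lemma count_lemma (m e M K : ℕ) (hm : 2 ≤ m) (he : 3 ≤ e) (hM : 1 ≤ M) (hK : e - 2 ≤ m * K) :
    ∃ T : Finset ℤ[X], T.card ≤ e * 3 ^ (m + e + 1) * M ^ (m + K) ∧
      ∀ (g h : ℤ[X]) (B j : ℕ), g.Monic → h.Monic → g.natDegree = m → h.natDegree = e →
      h.coeff 0 = 0 → 1 ≤ B → B ^ m ≤ M → 1 ≤ j → j < e → (∀ i, |h.coeff i| ≤ B) →
      (|h.coeff j| = B ∨ h.coeff j = 0) → (∀ i, |g.coeff i| ≤ M) → |g.coeff 1| * B ≤ M →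
      g.comp h ∈ T := by
  classical
  obtain ⟨Y, hY1, hYM, hY⟩ : ∃ Y : ℕ, 1 ≤ Y ∧ Y ^ m ≤ M ∧ ∀ B, B ^ m ≤ M → B ≤ Y := by
    refine ⟨Nat.findGreatest (fun y => y ^ m ≤ M) M, ?_, ?_, ?_⟩
    · exact Nat.le_findGreatest hM (by simpa using hM)
    · exact Nat.findGreatest_spec (P := fun y => y ^ m ≤ M) (m := 1) hM (by simpa using hM)
    · intro B hB
      exact Nat.le_findGreatest ((Nat.le_self_pow (by omega) B).trans hB) hB
  have hYleM : Y ≤ M := (Nat.le_self_pow (by omega) Y).trans hYM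
  have key : ∀ B j : ℕ, ∃ T : Finset ℤ[X], (1 ≤ B → B ≤ Y → 1 ≤ j → j < e →
      T.card ≤ 3 ^ (m + e + 1) * M ^ m * Y ^ (e - 3) ∧
      ∀ (g h : ℤ[X]), g.Monic → h.Monic → g.natDegree = m → h.natDegree = e →
      h.coeff 0 = 0 → (∀ i, |h.coeff i| ≤ B) →
      (|h.coeff j| = B ∨ h.coeff j = 0) → (∀ i, |g.coeff i| ≤ M) → |g.coeff 1| * B ≤ M →
      g.comp h ∈ T) := by
    intro B j
    by_cases hc : 1 ≤ B ∧ B ≤ Y ∧ 1 ≤ j ∧ j < e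
    · obtain ⟨hB, hBY, hj, hje⟩ := hc
      obtain ⟨S1, c1, p1⟩ := card_a m M B hm hB (hBY.trans hYleM)
      obtain ⟨S2, c2, p2⟩ := card_b e j B hj hje hB
      refine ⟨(S1 ×ˢ S2).image (fun p => p.1.comp p.2), fun _ _ _ _ => ⟨?_, ?_⟩⟩
      · refine Finset.card_image_le.trans ?_
        rw [Finset.card_product]
        have h1 : S1.card * S2.card * B ^ 4 ≤ (3 ^ (m + e + 1) * M ^ m * B ^ (e - 3)) * B ^ 4 := by
          calc S1.card * S2.card * B ^ 4 = (S1.card * B) * (S2.card * B ^ 3) := by ring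
            _ ≤ (3 * M) ^ m * (3 * B) ^ (e + 1) := Nat.mul_le_mul c1 c2
            _ = _ := by
              obtain ⟨k, rfl⟩ : ∃ k, e = k + 3 := ⟨e - 3, by omega⟩
              simp only [Nat.add_sub_cancel]
              ring
        have h2 := Nat.le_of_mul_le_mul_right h1 (by positivity)
        exact h2.trans (Nat.mul_le_mul_left _ (Nat.pow_le_pow_left hBY _))
      · intro g h a1 a2 a3 a4 a5 a6 a7 a8 a9
        exact Finset.mem_image.2 ⟨(g, h), Finset.mem_product.2
          ⟨p1 g a1 a3 a8 a9, p2 h a2 a4 a5 a6 a7⟩, rfl⟩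
    · exact ⟨∅, fun a b c d => absurd ⟨a, b, c, d⟩ hc⟩
  choose T hT using key
  refine ⟨(Finset.Icc 1 Y ×ˢ Finset.Ico 1 e).biUnion (fun p => T p.1 p.2), ?_, ?_⟩
  · refine (Finset.card_biUnion_le_card_mul _ _ (3 ^ (m + e + 1) * M ^ m * Y ^ (e - 3)) ?_).trans ?_
    · rintro ⟨B, j⟩ hp
      simp only [Finset.mem_product, Finset.mem_Icc, Finset.mem_Ico] at hp
      exact (hT B j hp.1.1 hp.1.2 hp.2.1 hp.2.2).1
    · rw [Finset.card_product, Nat.card_Icc, Nat.card_Ico]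
      have hY2 : Y * Y ^ (e - 3) ≤ M ^ K := by
        calc Y * Y ^ (e - 3) = Y ^ (e - 2) := by
              rw [← pow_succ']; congr 1; omega
          _ ≤ Y ^ (m * K) := Nat.pow_le_pow_right hY1 hK
          _ = (Y ^ m) ^ K := pow_mul _ _ _
          _ ≤ M ^ K := Nat.pow_le_pow_left hYM _
      calc _ ≤ (Y * e) * (3 ^ (m + e + 1) * M ^ m * Y ^ (e - 3)) := by
            apply Nat.mul_le_mul_right
            apply Nat.mul_le_mul <;> omega
        _ = e * 3 ^ (m + e + 1) * M ^ m * (Y * Y ^ (e - 3)) := by ring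
        _ ≤ e * 3 ^ (m + e + 1) * M ^ m * M ^ K := Nat.mul_le_mul_left _ hY2
        _ = _ := by ring
  · intro g h B j a1 a2 a3 a4 a5 hB hBM hj hje a6 a7 a8 a9
    refine Finset.mem_biUnion.2 ⟨(B, j), ?_, ?_⟩
    · simp only [Finset.mem_product, Finset.mem_Icc, Finset.mem_Ico]
      exact ⟨⟨hB, hY B hBM⟩, hj, hje⟩
    · exact (hT B j hB (hY B hBM) hj hje).2 g h a1 a2 a3 a4 a5 a6 a7 a8 a9

lemma arith_lemma (d m e : ℕ) (hdm : d = m * e) (hm : 2 ≤ m) (he : d.minFac < e) (hne : d ≠ 6) :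
    3 ≤ e ∧ m + 1 ≤ d / d.minFac ∧ e - 2 ≤ m * (d / d.minFac - 1 - m) := by
  have hd1 : d ≠ 1 := by
    rintro rfl
    have := Nat.eq_one_of_mul_eq_one_right hdm.symm
    omega
  have hp := Nat.minFac_prime hd1
  have hl2 := hp.two_le
  have hlm : d.minFac ≤ m := Nat.minFac_le_of_dvd hm ⟨e, hdm⟩
  have hk : d / d.minFac * d.minFac = m * e := by
    rw [Nat.div_mul_cancel (Nat.minFac_dvd d), hdm]
  have h2 : 2 ∣ d → d.minFac = 2 := fun h => le_antisymm (Nat.minFac_le_of_dvd le_rfl h) hl2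
  generalize hl : d.minFac = l at *
  generalize d / l = k at *
  have main : m * m * l + m * l + e * l ≤ e * m * m + 2 * l := by
    by_cases hc : l + 2 ≤ e
    · obtain ⟨a, rfl⟩ := Nat.exists_eq_add_of_le hc
      obtain ⟨b, rfl⟩ := Nat.exists_eq_add_of_le hlm
      nlinarith [Nat.zero_le (a * b), Nat.zero_le (a * b * b), Nat.zero_le (a * b * l),
        Nat.zero_le (b * b), Nat.zero_le (b * l), Nat.mul_le_mul_left (a * l) (show 1 ≤ l by omega)]
    · have hel : e = l + 1 := by omega
      have hl' : l = 2 := by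
        rcases hp.eq_two_or_odd with h | h
        · exact h
        · exact h2 (hdm ▸ Dvd.dvd.mul_left (by omega) m)
      subst hl'
      subst hel
      have : m ≠ 2 := by rintro rfl; omega
      have : m ≠ 3 := by rintro rfl; omega
      have : 4 ≤ m := by omega
      nlinarith
  have h3 : m * m + m + e ≤ m * k + 2 := by
    have : (m * m + m + e) * l ≤ (m * k + 2) * l := by
      calc (m * m + m + e) * l = m * m * l + m * l + e * l := by ring
        _ ≤ e * m * m + 2 * l := main
        _ = m * (k * l) + 2 * l := by rw [hk]; ring
        _ = _ := by ring
    exact Nat.le_of_mul_le_mul_right this (by omega)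
  have h4 : m + 1 ≤ k := by
    by_contra hcon
    have : m * k ≤ m * m := Nat.mul_le_mul_left _ (by omega)
    omega
  refine ⟨by omega, h4, ?_⟩
  obtain ⟨t, rfl⟩ := Nat.exists_eq_add_of_le h4
  have : m + 1 + t - 1 - m = t := by omega
  rw [this]
  have : m * (m + 1 + t) = m * m + m + m * t := by ring
  omega

lemma per_degree (m e K : ℕ) (hm : 2 ≤ m) (he : 3 ≤ e) (hK : e - 2 ≤ m * K) :
    ∃ c : ℕ, ∀ H : ℕ, 1 ≤ H → ∃ T : Finset ℤ[X], T.card ≤ c * H ^ (m + K) ∧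
      ∀ f g h : ℤ[X], f.Monic → HeightLe f H → g.natDegree = m → h.natDegree = e →
        f = g.comp h → f ∈ T := by
  set d := m * e with hd
  set C0 : ℕ := (2 ^ e * (2 ^ d * (d + 1))) with hC0
  have hC01 : 1 ≤ C0 := Nat.one_le_iff_ne_zero.2 (by positivity)
  refine ⟨e * 3 ^ (m + e + 1) * (C0 ^ m) ^ (m + K), fun H hH => ?_⟩
  obtain ⟨T, hT, hmem⟩ := count_lemma m e (C0 ^ m * H) K hm he
    (Nat.mul_pos (by positivity) hH) hK
  refine ⟨T, hT.trans (le_of_eq (by rw [mul_pow]; ring)), ?_⟩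
  intro f g₀ h₀ hf hH' hg₀ hh₀ hfc₀
  obtain ⟨g, h, hg, hh, hgd, hhd, h0, hfc⟩ :=
    normalize_decomp_s7 f g₀ h₀ hf (by omega) (by omega) hfc₀
  rw [hg₀] at hgd
  rw [hh₀] at hhd
  rw [hfc]
  obtain ⟨j, hj, hjmax⟩ := Finset.exists_max_image (Finset.Ico 1 e)
    (fun i => (h.coeff i).natAbs) ⟨1, Finset.mem_Ico.2 ⟨le_rfl, by omega⟩⟩
  rw [Finset.mem_Ico] at hj
  set B := max 1 (h.coeff j).natAbs with hB
  have hB1 : 1 ≤ B := le_max_left _ _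
  have hM1 := one_le_mm h hh.ne_zero
  have hBM : (B : ℝ) ≤ 2 ^ e * mm h := by
    rw [hB]
    push_cast
    apply max_le
    · have : (1 : ℝ) ≤ 2 ^ e := one_le_pow₀ (by norm_num)
      nlinarith
    · have := coeff_le_mm e h hhd.le j
      simpa [Nat.cast_natAbs] using this
  have hco : ∀ i, i ≤ m → (g.coeff i).natAbs * B ^ i ≤ C0 ^ m * H := by
    intro i hi
    have h1 := coeff_bound d h hh.ne_zero h0 i g H (by rw [hgd, hhd]) (by
      intro k; rw [← hfc]; have := hH' k; exact_mod_cast this)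
    have h2 : (((g.coeff i).natAbs * B ^ i : ℕ) : ℝ) ≤ ((C0 ^ m * H : ℕ) : ℝ) := by
      push_cast
      rw [Nat.cast_natAbs, Int.cast_abs]
      calc |(g.coeff i : ℝ)| * (B : ℝ) ^ i ≤ |(g.coeff i : ℝ)| * (2 ^ e * mm h) ^ i := by gcongr
        _ = (2 ^ e) ^ i * (|(g.coeff i : ℝ)| * mm h ^ i) := by rw [mul_pow]; ring
        _ ≤ (2 ^ e) ^ i * ((2 ^ d * (d + 1)) ^ i * H) := by gcongr
        _ = (C0 : ℝ) ^ i * H := by rw [hC0]; push_cast; rw [mul_pow (2 ^ e : ℝ)]; ring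
        _ ≤ (C0 : ℝ) ^ m * H := by
          gcongr
          exact_mod_cast hC01
    exact_mod_cast h2
  refine hmem g h B j hg hh hgd hhd h0 hB1 ?_ hj.1 hj.2 ?_ ?_ ?_ ?_
  · have := hco m le_rfl
    rw [← hgd, hg.coeff_natDegree] at this
    rw [← hgd]
    simpa using this
  · intro i
    have : (h.coeff i).natAbs ≤ B := by
      rcases Nat.eq_zero_or_pos i with rfl | hi
      · simp [h0]
      · rcases lt_trichotomy i e with hie | hie | hie
        · exact (hjmax i (Finset.mem_Ico.2 ⟨hi, hie⟩)).trans (le_max_right _ _)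
        · rw [hie, ← hhd, hh.coeff_natDegree]; simpa using hB1
        · rw [coeff_eq_zero_of_natDegree_lt (by omega)]; simp
    rw [Int.abs_eq_natAbs]
    exact_mod_cast this
  · rw [Int.abs_eq_natAbs]
    omega
  · intro i
    by_cases hi : i ≤ m
    · have h1 := hco i hi
      have h2 : (g.coeff i).natAbs * 1 ≤ (g.coeff i).natAbs * B ^ i :=
        Nat.mul_le_mul_left _ (Nat.one_le_pow _ _ hB1)
      have h3 : (g.coeff i).natAbs ≤ C0 ^ m * H := by omega
      rw [Int.abs_eq_natAbs]
      exact_mod_cast h3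
    · rw [coeff_eq_zero_of_natDegree_lt (by omega)]
      simp only [abs_zero]
      positivity
  · have h1 := hco 1 (by omega)
    rw [Int.abs_eq_natAbs]
    rw [pow_one] at h1
    exact_mod_cast h1

lemma finite_height (d H : ℕ) : {f : ℤ[X] | f.natDegree = d ∧ HeightLe f H}.Finite := by
  classical
  refine Set.Finite.subset (Finset.finite_toSet ((Fintype.piFinset
    (fun _ : Fin (d + 1) => Finset.Icc (-(H : ℤ)) H)).image (fun a => ofFn (d + 1) a))) ?_
  rintro f ⟨hd, hf⟩
  rw [Finset.mem_coe]
  refine Finset.mem_image.2 ⟨toFn (d + 1) f, ?_, ?_⟩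
  · rw [Fintype.mem_piFinset]
    intro i
    simp only [toFn, LinearMap.pi_apply, lcoeff_apply, Finset.mem_Icc]
    rw [← abs_le]; exact hf i
  · exact ofFn_comp_toFn_eq_id_of_natDegree_lt (by omega)

lemma not_decomposable_of_prime (h : ℤ[X]) (hp : h.natDegree.Prime) : ¬ Decomposable h := by
  rintro ⟨u, v, hu, hv, rfl⟩
  rw [natDegree_comp] at hp
  exact Nat.not_prime_mul (by omega) (by omega) hp

theorem stmt_7 (d : ℕ) (hd : 4 ≤ d) (hcomp : ¬ Nat.Prime d) (hne : d ≠ 6) :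
    ∃ c : ℝ, 0 < c ∧ ∀ H : ℕ, 2 ≤ H →
      |(DdMonic d H : ℝ) - (IdMonic d d.minFac H : ℝ)| ≤ c * (H : ℝ) ^ (d / d.minFac - 1) := by
  classical
  have hp := Nat.minFac_prime (show d ≠ 1 by omega)
  have hl2 := hp.two_le
  have hdl : 2 ≤ d / d.minFac := by
    have h1 := Nat.minFac_sq_le_self (by omega) hcomp
    rw [Nat.le_div_iff_mul_le (by omega)]
    nlinarith
  have key : ∀ e : ℕ, ∃ c : ℕ, ∀ H : ℕ, 1 ≤ H → ∃ T : Finset ℤ[X],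
      T.card ≤ c * H ^ (d / d.minFac - 1) ∧
      ∀ f g h : ℤ[X], f.Monic → f.natDegree = d → HeightLe f H → 2 ≤ g.natDegree →
        h.natDegree = e → d.minFac < e → f = g.comp h → f ∈ T := by
    intro e
    by_cases hc : ∃ m, 2 ≤ m ∧ d = m * e ∧ d.minFac < e
    · obtain ⟨m, hm, hdm, hle⟩ := hc
      obtain ⟨he3, hmk, hK⟩ := arith_lemma d m e hdm hm hle hne
      obtain ⟨c, hc⟩ := per_degree m e (d / d.minFac - 1 - m) hm he3 hK
      refine ⟨c, fun H hH => ?_⟩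
      obtain ⟨T, hT, hmem⟩ := hc H hH
      refine ⟨T, ?_, ?_⟩
      · rwa [show m + (d / d.minFac - 1 - m) = d / d.minFac - 1 by omega] at hT
      · intro f g h hf hfd hfH hg hh _ hfc
        refine hmem f g h hf hfH ?_ hh hfc
        rw [hfc, natDegree_comp, hh, hdm] at hfd
        exact Nat.eq_of_mul_eq_mul_right (by omega) hfd
    · refine ⟨0, fun H _ => ⟨∅, by simp, ?_⟩⟩
      intro f g h hf hfd hfH hg hh hle hfc
      refine absurd ⟨g.natDegree, hg, ?_, hle⟩ hc
      rw [← hfd, hfc, natDegree_comp, hh]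
  choose c hc using key
  refine ⟨(∑ e ∈ Finset.range (d + 1), c e : ℕ) + 1, by positivity, fun H hH => ?_⟩
  have hc' := fun e => hc e H (by omega)
  choose T hTc hT using hc'
  set DS : Set ℤ[X] := {f : ℤ[X] | f.Monic ∧ f.natDegree = d ∧ HeightLe f H ∧ Decomposable f}
    with hDS
  set IS : Set ℤ[X] := {f : ℤ[X] | f.Monic ∧ f.natDegree = d ∧ HeightLe f H ∧
    ∃ g h : ℤ[X], ¬ Decomposable g ∧ ¬ Decomposable h ∧
      g.natDegree = d / d.minFac ∧ h.natDegree = d.minFac ∧ f = g.comp h} with hIS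
  have hD : DdMonic d H = DS.ncard := rfl
  have hI : IdMonic d d.minFac H = IS.ncard := rfl
  have hDfin : DS.Finite := (finite_height d H).subset (fun f hf => ⟨hf.2.1, hf.2.2.1⟩)
  have hsub : IS ⊆ DS := by
    rintro f ⟨h1, h2, h3, g, h, _, _, hg, hh, hfc⟩
    exact ⟨h1, h2, h3, g, h, by omega, by omega, hfc⟩
  have hIfin := hDfin.subset hsub
  have hle : IS.ncard ≤ DS.ncard := Set.ncard_le_ncard hsub hDfin
  have hsub2 : DS ⊆ IS ∪ ↑((Finset.range (d + 1)).biUnion T) := by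
    rintro f ⟨h1, h2, h3, g, h, hg, hh, hfc⟩
    have hdeg : g.natDegree * h.natDegree = d := by rw [← natDegree_comp, ← hfc, h2]
    have hbig : ∀ g h : ℤ[X], 2 ≤ g.natDegree → d.minFac < h.natDegree → f = g.comp h →
        f ∈ IS ∪ ↑((Finset.range (d + 1)).biUnion T) := by
      intro g h hg hh hfc
      right
      have hdeg : g.natDegree * h.natDegree = d := by rw [← natDegree_comp, ← hfc, h2]
      rw [Finset.mem_coe]
      refine Finset.mem_biUnion.2 ⟨h.natDegree, Finset.mem_range.2 ?_, ?_⟩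
      · nlinarith
      · exact hT _ f g h h1 h2 h3 hg rfl hh hfc
    have hlh : d.minFac ≤ h.natDegree := Nat.minFac_le_of_dvd hh ⟨_, by rw [mul_comm, hdeg]⟩
    rcases hlh.lt_or_eq with hlt | heq
    · exact hbig g h hg hlt hfc
    · by_cases hgd : Decomposable g
      · obtain ⟨u, v, hu, hv, rfl⟩ := hgd
        refine hbig u (v.comp h) hu ?_ (by rw [hfc, comp_assoc])
        rw [natDegree_comp, ← heq]
        nlinarith
      · left
        refine ⟨h1, h2, h3, g, h, hgd, not_decomposable_of_prime h (heq ▸ hp), ?_, heq.symm, hfc⟩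
        rw [← heq] at hdeg
        exact (Nat.div_eq_of_eq_mul_left (by omega) hdeg.symm).symm
  have hcard : DS.ncard ≤ IS.ncard + (∑ e ∈ Finset.range (d + 1), c e) * H ^ (d / d.minFac - 1) := by
    refine (Set.ncard_le_ncard hsub2 (hIfin.union (Finset.finite_toSet _))).trans ?_
    refine (Set.ncard_union_le _ _).trans ?_
    rw [Set.ncard_coe_finset, Finset.sum_mul]
    exact Nat.add_le_add_left (Finset.card_biUnion_le.trans
      (Finset.sum_le_sum fun e _ => hTc e)) _
  rw [hD, hI, abs_of_nonneg (by rw [sub_nonneg]; exact_mod_cast hle)]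
  have hcardR : (DS.ncard : ℝ) ≤ IS.ncard +
      ((∑ e ∈ Finset.range (d + 1), c e : ℕ) : ℝ) * (H : ℝ) ^ (d / d.minFac - 1) := by
    exact_mod_cast hcard
  have hpos : (0 : ℝ) ≤ (H : ℝ) ^ (d / d.minFac - 1) := by positivity
  rw [add_mul]
  linarith
end
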